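/- Let q ≥ 2 be an integer and 0 < u < 1/q. Then (u^{-2} − q)∫_0^∞ e^{-(qu+1/u)t} e^{(q+1)t} · K_{q+1}(t, x_0, x_0) dt = 1/u − (q−1)·u/(1−u²), where K_{q+1}(t, x_0, x_0) = e^{-(q+1)t}[ I_0(2√q t) − (q−1)∑_{j=1}^∞ q^{-j} I_{2j}(2√q t) ] is the on-diagonal heat kernel of the (q+1)-regular tree. -/

import Mathlib

/-- Modified Bessel function of the first kind of integer order `n ≥ 0`,
defined by its power series. -/
noncomputable def besselI (n : ℕ) (t : ℝ) : ℝ :=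
  ∑' k : ℕ, (t / 2) ^ (2 * k + n) / (k.factorial * (k + n).factorial)

/-- On-diagonal heat kernel of the `(q+1)`-regular tree. -/
noncomputable def treeHeatKernelDiag (q : ℕ) (t : ℝ) : ℝ :=
  Real.exp (-((q : ℝ) + 1) * t) *
    (besselI 0 (2 * Real.sqrt q * t) -
      ((q : ℝ) - 1) * ∑' j : ℕ, (q : ℝ) ^ (-((j : ℝ) + 1)) *
        besselI (2 * (j + 1)) (2 * Real.sqrt q * t))

open MeasureTheory in
theorem integrableOn_pow_mul_exp_neg_mul_and_integral_eq (m : ℕ) {s : ℝ} (hs : 0 < s) :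
    IntegrableOn (fun t : ℝ => t ^ m * Real.exp (-(s * t))) (Set.Ioi 0) ∧
      ∫ t in Set.Ioi (0 : ℝ), t ^ m * Real.exp (-(s * t)) = m.factorial / s ^ (m + 1) := by
  have h := Real.integral_rpow_mul_exp_neg_mul_Ioi (a := (m : ℝ) + 1) (by positivity) hs
  simp only [add_sub_cancel_right, Real.rpow_natCast, Real.Gamma_nat_eq_factorial] at h
  have h' : ∫ t in Set.Ioi (0 : ℝ), t ^ m * Real.exp (-(s * t)) = m.factorial / s ^ (m + 1) := by
    rw [h, ← Nat.cast_succ, Real.rpow_natCast]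
    simp [div_eq_inv_mul]
  refine ⟨Integrable.of_integral_ne_zero ?_, h'⟩
  rw [h']
  positivity

theorem choose_mul_pow_le {x : ℝ} (hx0 : 0 ≤ x) (hx : 2 * x < 1) (n k : ℕ) :
    ((2 * k + n).choose k : ℝ) * x ^ (2 * k + n) ≤ ((2 * x) ^ 2) ^ k := by
  calc ((2 * k + n).choose k : ℝ) * x ^ (2 * k + n)
      ≤ 2 ^ (2 * k + n) * x ^ (2 * k + n) := by
        gcongr
        exact_mod_cast Nat.choose_le_two_pow _ _
    _ = ((2 * x) ^ 2) ^ k * (2 * x) ^ n := by rw [← mul_pow, pow_add, pow_mul]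
    _ ≤ ((2 * x) ^ 2) ^ k * 1 := by
        gcongr
        exact pow_le_one₀ (by positivity) hx.le
    _ = _ := mul_one _

theorem summable_choose_mul_pow {x : ℝ} (hx0 : 0 ≤ x) (hx : 2 * x < 1) (n : ℕ) :
    Summable fun k : ℕ => ((2 * k + n).choose k : ℝ) * x ^ (2 * k + n) :=
  .of_nonneg_of_le (fun k => by positivity) (choose_mul_pow_le hx0 hx n)
    (summable_geometric_of_lt_one (by positivity) (by nlinarith))

theorem tsum_choose_mul_pow_le {x : ℝ} (hx0 : 0 ≤ x) (hx : 2 * x < 1) (n : ℕ) :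
    ∑' k : ℕ, ((2 * k + n).choose k : ℝ) * x ^ (2 * k + n) ≤ (1 - (2 * x) ^ 2)⁻¹ := by
  have h1 : (2 * x) ^ 2 < 1 := by nlinarith
  rw [← tsum_geometric_of_lt_one (by positivity) h1]
  exact (summable_choose_mul_pow hx0 hx n).tsum_le_tsum (choose_mul_pow_le hx0 hx n)
    (summable_geometric_of_lt_one (by positivity) h1)

theorem tsum_choose_mul_pow_add_one {x : ℝ} (hx0 : 0 ≤ x) (hx : 2 * x < 1) (n : ℕ) :
    ∑' k : ℕ, ((2 * k + (n + 1)).choose k : ℝ) * x ^ (2 * k + (n + 1)) =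
      x * (∑' k : ℕ, ((2 * k + n).choose k : ℝ) * x ^ (2 * k + n) +
        ∑' k : ℕ, ((2 * k + (n + 2)).choose k : ℝ) * x ^ (2 * k + (n + 2))) := by
  rw [(summable_choose_mul_pow hx0 hx (n + 1)).tsum_eq_zero_add,
    (summable_choose_mul_pow hx0 hx n).tsum_eq_zero_add, add_assoc,
    ← ((summable_nat_add_iff 1).2 (summable_choose_mul_pow hx0 hx n)).tsum_add
      (summable_choose_mul_pow hx0 hx (n + 2)), mul_add, ← tsum_mul_left]
  congr 1
  · simp [pow_succ, mul_comm]
  · refine tsum_congr fun k => ?_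
    rw [show 2 * (k + 1) + (n + 1) = (2 * k + n + 2) + 1 by ring, Nat.choose_succ_succ,
      show 2 * (k + 1) + n = 2 * k + n + 2 by ring, show 2 * k + (n + 2) = 2 * k + n + 2 by ring]
    push_cast
    ring

theorem tsum_choose_mul_pow_zero {x : ℝ} (hx0 : 0 ≤ x) (hx : 2 * x < 1) :
    ∑' k : ℕ, ((2 * k + 0).choose k : ℝ) * x ^ (2 * k + 0) =
      1 + 2 * x * ∑' k : ℕ, ((2 * k + 1).choose k : ℝ) * x ^ (2 * k + 1) := by
  rw [(summable_choose_mul_pow hx0 hx 0).tsum_eq_zero_add, ← tsum_mul_left]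
  congr 1
  · simp
  · refine tsum_congr fun k => ?_
    rw [show 2 * (k + 1) + 0 = (2 * k + 1) + 1 by ring, Nat.choose_succ_succ,
      Nat.choose_symm_half]
    push_cast
    ring

theorem two_mul_div_one_add_sq_lt_one {w : ℝ} (hw : w < 1) : 2 * (w / (1 + w ^ 2)) < 1 := by
  rw [mul_div_assoc', div_lt_one (by positivity)]
  nlinarith [sq_pos_of_pos (sub_pos.2 hw)]

/-- The generating function of the binomial coefficients `(2 * k + n).choose k`, in the
uniformizing variable `w`. -/
theorem tsum_choose_mul_div_pow {w : ℝ} (hw0 : 0 < w) (hw : w < 1) (n : ℕ) :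
    ∑' k : ℕ, ((2 * k + n).choose k : ℝ) * (w / (1 + w ^ 2)) ^ (2 * k + n) =
      w ^ n * ((1 + w ^ 2) / (1 - w ^ 2)) := by
  have hx0 : 0 ≤ w / (1 + w ^ 2) := by positivity
  have hx := two_mul_div_one_add_sq_lt_one hw
  have hrec := tsum_choose_mul_pow_add_one hx0 hx
  have hzero := tsum_choose_mul_pow_zero hx0 hx
  have hbound := tsum_choose_mul_pow_le hx0 hx
  have hnonneg (n : ℕ) :
      0 ≤ ∑' k : ℕ, ((2 * k + n).choose k : ℝ) * (w / (1 + w ^ 2)) ^ (2 * k + n) :=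
    tsum_nonneg fun k => by positivity
  generalize (1 - (2 * (w / (1 + w ^ 2))) ^ 2)⁻¹ = B at hbound
  generalize hS : (fun n : ℕ => ∑' k : ℕ, ((2 * k + n).choose k : ℝ) *
    (w / (1 + w ^ 2)) ^ (2 * k + n)) = S
  have hS' (n : ℕ) : ∑' k : ℕ, ((2 * k + n).choose k : ℝ) *
    (w / (1 + w ^ 2)) ^ (2 * k + n) = S n := congrFun hS n
  simp only [hS'] at hrec hzero hbound hnonneg ⊢
  have hstep (n : ℕ) : w * (S (n + 2) - w * S (n + 1)) = S (n + 1) - w * S n := by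
    have := hrec n
    field_simp at this
    linarith
  have hiter (n : ℕ) : w ^ n * (S (n + 1) - w * S n) = S 1 - w * S 0 := by
    induction n with
    | zero => simp
    | succ n ih => rw [pow_succ, mul_assoc, hstep, ih]
  have hlim : Filter.Tendsto (fun n : ℕ => w ^ n * (S (n + 1) - w * S n)) .atTop (nhds 0) := by
    refine (tendsto_pow_atTop_nhds_zero_of_lt_one hw0.le hw).zero_mul_isBoundedUnder_le
      (Filter.isBoundedUnder_of ⟨B, fun n => ?_⟩)
    rw [Function.comp_apply, Real.norm_eq_abs, abs_le]
    constructor <;> nlinarith [hbound n, hbound (n + 1), hnonneg n, hnonneg (n + 1)]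
  simp only [hiter] at hlim
  have hS1 : S 1 - w * S 0 = 0 := tendsto_nhds_unique tendsto_const_nhds hlim
  have hgeom (n : ℕ) : S (n + 1) = w * S n := by
    have := hiter n
    rw [hS1, mul_eq_zero] at this
    linarith [this.resolve_left (pow_ne_zero n hw0.ne')]
  have hne : 1 - w ^ 2 ≠ 0 := by nlinarith
  have hS0 : S 0 = (1 + w ^ 2) / (1 - w ^ 2) := by
    rw [hgeom 0] at hzero
    rw [eq_div_iff hne]
    field_simp at hzero
    linarith
  induction n with
  | zero => simp [hS0]
  | succ n ih => rw [hgeom, ih, pow_succ']; ring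
open MeasureTheory in
theorem integral_exp_mul_besselI (n : ℕ) {a s w : ℝ} (ha : 0 < a) (hs : 0 < s) (hw0 : 0 < w)
    (hw : w < 1) (h : a / (2 * s) = w / (1 + w ^ 2)) :
    ∫ t in Set.Ioi (0 : ℝ), Real.exp (-(s * t)) * besselI n (a * t) =
      w ^ n * ((1 + w ^ 2) / (1 - w ^ 2)) / s := by
  have hx0 : 0 ≤ w / (1 + w ^ 2) := by positivity
  have hx := two_mul_div_one_add_sq_lt_one hw
  let F (k : ℕ) (t : ℝ) : ℝ := (a / 2) ^ (2 * k + n) / (k.factorial * (k + n).factorial) *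
    (t ^ (2 * k + n) * Real.exp (-(s * t)))
  have hF (k : ℕ) : IntegrableOn (F k) (Set.Ioi 0) :=
    (integrableOn_pow_mul_exp_neg_mul_and_integral_eq _ hs).1.const_mul _
  have hFint (k : ℕ) : ∫ t in Set.Ioi (0 : ℝ), F k t =
      ((2 * k + n).choose k : ℝ) * (w / (1 + w ^ 2)) ^ (2 * k + n) / s := by
    rw [integral_const_mul, (integrableOn_pow_mul_exp_neg_mul_and_integral_eq _ hs).2, ← h,
      Nat.cast_choose ℝ (by lia : k ≤ 2 * k + n), show 2 * k + n - k = k + n by lia,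
      ← div_div a 2 s, div_pow (a / 2), pow_succ]
    field_simp
  have hFnorm (k : ℕ) : ∫ t in Set.Ioi (0 : ℝ), ‖F k t‖ = ∫ t in Set.Ioi (0 : ℝ), F k t := by
    refine setIntegral_congr_fun measurableSet_Ioi fun t (ht : 0 < t) => ?_
    exact Real.norm_of_nonneg (by positivity)
  have key := integral_tsum_of_summable_integral_norm hF (by
    simp only [hFnorm, hFint]
    exact (summable_choose_mul_pow hx0 hx n).div_const s)
  simp only [hFint, tsum_div_const, tsum_choose_mul_div_pow hw0 hw] at key
  rw [key]
  congr 1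
  ext t
  rw [besselI, ← tsum_mul_left]
  refine tsum_congr fun k => ?_
  simp only [F]
  rw [mul_div_right_comm a t 2, mul_pow]
  ring

theorem besselI_nonneg (n : ℕ) {t : ℝ} (ht : 0 ≤ t) : 0 ≤ besselI n t :=
  tsum_nonneg fun k => by positivity

theorem Gtransform_tree_diagonal (q : ℕ) (hq : 2 ≤ q) (u : ℝ)
    (hu0 : 0 < u) (hu : u < 1 / q) :
    (u ^ (-2 : ℤ) - (q : ℝ)) *
        ∫ t in Set.Ioi (0:ℝ),
          Real.exp (-((q : ℝ) * u + 1 / u) * t) * Real.exp (((q : ℝ) + 1) * t) *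
            treeHeatKernelDiag q t =
      1 / u - ((q : ℝ) - 1) * u / (1 - u ^ 2) := by
  have hq' : (2 : ℝ) ≤ q := by exact_mod_cast hq
  have hq0 : (0 : ℝ) < q := by linarith
  have hqu : q * u < 1 := by rwa [lt_div_iff₀ hq0, mul_comm] at hu
  have hu1 : u < 1 := by nlinarith
  have hqu2 : q * u ^ 2 < 1 := by nlinarith
  have hu2 : u ^ 2 < 1 := by nlinarith
  set r := Real.sqrt q with hr
  have hr0 : 0 < r := Real.sqrt_pos.2 hq0
  have hr2 : r ^ 2 = q := Real.sq_sqrt hq0.le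
  set s := q * u + 1 / u with hs
  have hs0 : 0 < s := by positivity
  have hw0 : 0 < r * u := by positivity
  have hw2 : (r * u) ^ 2 = q * u ^ 2 := by rw [mul_pow, hr2]
  have hw : r * u < 1 := by nlinarith
  have laplace (n : ℕ) : ∫ t in Set.Ioi (0 : ℝ), Real.exp (-(s * t)) * besselI n (2 * r * t) =
      (r * u) ^ n * (u / (1 - q * u ^ 2)) := by
    rw [integral_exp_mul_besselI n (by positivity) hs0 hw0 hw (by
      rw [hw2, hs]
      field_simp
      ring), hw2,
      hs]
    have : 1 - q * u ^ 2 ≠ 0 := by linarith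
    field_simp
    ring
  have hD : 0 < u / (1 - q * u ^ 2) := div_pos hu0 (by linarith)
  have hint (n : ℕ) : MeasureTheory.IntegrableOn (fun t => Real.exp (-(s * t)) * besselI n (2 * r * t))
      (Set.Ioi 0) := by
    refine MeasureTheory.Integrable.of_integral_ne_zero ?_
    rw [laplace]
    positivity
  let F (j : ℕ) (t : ℝ) : ℝ := (q : ℝ) ^ (-((j : ℝ) + 1)) *
    (Real.exp (-(s * t)) * besselI (2 * (j + 1)) (2 * r * t))
  have hF (j : ℕ) : MeasureTheory.IntegrableOn (F j) (Set.Ioi 0) := (hint _).const_mul _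
  have hFint (j : ℕ) : ∫ t in Set.Ioi (0 : ℝ), F j t =
      (u ^ 2) ^ j * (u ^ 2 * (u / (1 - q * u ^ 2))) := by
    rw [MeasureTheory.integral_const_mul, laplace, pow_mul, hw2, Real.rpow_neg hq0.le, ← Nat.cast_succ,
      Real.rpow_natCast, Nat.succ_eq_add_one, mul_pow]
    field_simp
    ring
  have hFnorm (j : ℕ) : ∫ t in Set.Ioi (0 : ℝ), ‖F j t‖ = ∫ t in Set.Ioi (0 : ℝ), F j t := by
    refine MeasureTheory.setIntegral_congr_fun measurableSet_Ioi fun t (ht : 0 < t) => ?_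
    have := besselI_nonneg (2 * (j + 1)) (t := 2 * r * t) (by positivity)
    exact Real.norm_of_nonneg (by positivity)
  have hsum := MeasureTheory.integral_tsum_of_summable_integral_norm hF (by
    simp only [hFnorm, hFint]
    exact (summable_geometric_of_lt_one (by positivity) hu2).mul_right _)
  simp only [hFint, tsum_mul_right, tsum_geometric_of_lt_one (sq_nonneg u) hu2] at hsum
  have hsum_int : MeasureTheory.IntegrableOn (fun t => ∑' j, F j t) (Set.Ioi 0) := by
    refine MeasureTheory.Integrable.of_integral_ne_zero ?_
    rw [← hsum]
    have : 0 < 1 - u ^ 2 := by linarith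
    positivity
  have hkernel (t : ℝ) : Real.exp (-s * t) * Real.exp (((q : ℝ) + 1) * t) *
      treeHeatKernelDiag q t = Real.exp (-(s * t)) * besselI 0 (2 * r * t) -
        ((q : ℝ) - 1) * ∑' j, F j t := by
    have hexp : Real.exp (((q : ℝ) + 1) * t) * Real.exp (-((q : ℝ) + 1) * t) = 1 := by
      rw [← Real.exp_add, neg_add_rev, Real.exp_eq_one_iff]
      ring
    simp only [F, mul_left_comm _ (Real.exp (-(s * t))), tsum_mul_left]
    rw [treeHeatKernelDiag, ← hr, mul_assoc, ← mul_assoc (Real.exp (((q : ℝ) + 1) * t)), hexp,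
      neg_mul]
    ring
  simp only [hkernel]
  rw [MeasureTheory.integral_sub (hint 0) (hsum_int.const_mul _), MeasureTheory.integral_const_mul, laplace, ← hsum]
  have h1 : 1 - u ^ 2 * q ≠ 0 := by linarith
  have h2 : 1 - u ^ 2 ≠ 0 := by linarith
  rw [show u ^ (-2 : ℤ) = (u ^ 2)⁻¹ by rw [zpow_neg]; norm_cast]
  field_simp
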